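/- arXiv:1907.01449 — 8 statements merged into one kernel-verified Lean document; each statement's English description precedes it below -/
import Mathlib

section
/- Let q be a prime power, F_q a finite field with q elements, n a positive integer, and let α, β, γ ∈ F_q satisfy α + β + γ = 0 and γ ≠ 0. Let A ⊆ F_q^n be a finite set such that the only solutions of α·a₁ + β·a₂ + γ·a₃ = 0 with a₁, a₂, a₃ ∈ A are those with a₁ = a₂ = a₃. Then |A| ≤ 3·m_{(q−1)n/3}. -/
attribute [local instance] Classical.propDecidable

/-- The set `M_n^d` of monomials in `n` variables over a finite field `F` whose exponents are
all at most `Fintype.card F - 1` and whose total degree is at most `d`. -/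
noncomputable def capM (F : Type) [Field F] [Fintype F] (n : ℕ) (d : ℝ) :
    Finset (MvPolynomial (Fin n) F) :=
  (Finset.univ.filter
    (fun f : Fin n → Fin (Fintype.card F) => ((∑ i, (f i : ℕ) : ℕ) : ℝ) ≤ d)).image
    (fun f => MvPolynomial.monomial (Finsupp.equivFunOnFinite.symm fun i => ((f i : ℕ))) (1 : F))

/-- `m_d`, the cardinality of `M_n^d`. -/
noncomputable def capm (F : Type) [Field F] [Fintype F] (n : ℕ) (d : ℝ) : ℕ :=
  (capM F n d).card

open Finset in
/-- A subspace of `X → F` contains a vector whose support is at least as large as the dimension. -/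
theorem exists_finrank_le_card_support {F X : Type*} [Field F] [Fintype X]
    (V : Submodule F (X → F)) :
    ∃ v ∈ V, Module.finrank F V ≤ (univ.filter fun x => v x ≠ 0).card := by
  let supp : V → Finset X := fun v => univ.filter fun x => v.1 x ≠ 0
  obtain ⟨v, hv⟩ : ∃ v : V, ∀ w : V, (supp w).card ≤ (supp v).card := by
    have hfin : (Set.range fun v : V => (supp v).card).Finite :=
      (Set.finite_Iic (Fintype.card X)).subset (by
        rintro _ ⟨v, rfl⟩
        exact card_le_univ _)
    obtain ⟨_, ⟨v, rfl⟩, hv⟩ := hfin.exists_maximal (Set.range_nonempty _)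
    exact ⟨v, fun w => (le_total _ _).elim id fun h => hv ⟨w, rfl⟩ h⟩
  refine ⟨v, v.2, ?_⟩
  by_contra! hlt
  let restr : V →ₗ[F] (supp v → F) := (LinearMap.funLeft F F Subtype.val).comp V.subtype
  have hker : 0 < Module.finrank F (LinearMap.ker restr) := by
    have h1 := restr.finrank_range_add_finrank_ker
    have h2 := (LinearMap.range restr).finrank_le
    rw [Module.finrank_fintype_fun_eq_card, Fintype.card_coe] at h2
    have h3 : (supp v).card < Module.finrank F V := hlt
    omega
  have : Nontrivial (LinearMap.ker restr) := Module.finrank_pos_iff (R := F).mp hker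
  obtain ⟨⟨w, hw⟩, hw0⟩ := exists_ne (0 : LinearMap.ker restr)
  have hwv : ∀ x, v.1 x ≠ 0 → w.1 x = 0 := fun x hx =>
    congrFun (LinearMap.mem_ker.mp hw) ⟨x, by simpa [supp] using hx⟩
  obtain ⟨x, hx⟩ : ∃ x, w.1 x ≠ 0 := by
    by_contra! h
    exact hw0 (Subtype.ext (Subtype.ext (funext h)))
  have hvx : v.1 x = 0 := by
    by_contra h
    exact hx (hwv x h)
  refine (hv (v + w)).not_gt (card_lt_card ?_)
  rw [ssubset_iff_of_subset]
  · exact ⟨x, by simp [supp, hvx, hx], by simp [supp, hvx]⟩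
  · intro y hy
    have hy' : v.1 y ≠ 0 := by simpa [supp] using hy
    simp [supp, hwv y hy', hy']

open Finset in
/-- The slice rank of the diagonal tensor on `X` is at least `Fintype.card X`. -/
theorem card_le_of_diagonal_eq_sum_slices {F X I J K : Type*} [Field F] [Fintype X]
    [Fintype I] [Fintype J] [Fintype K]
    (f : I → X → F) (f' : I → X → X → F) (g : J → X → F) (g' : J → X → X → F)
    (h : K → X → F) (h' : K → X → X → F)
    (hT : ∀ x y z, (if x = y ∧ x = z then (1 : F) else 0) =
      ∑ i, f i x * f' i y z + ∑ j, g j y * g' j x z + ∑ k, h k z * h' k x y) :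
    Fintype.card X ≤ Fintype.card I + Fintype.card J + Fintype.card K := by
  let φ : (X → F) →ₗ[F] (K → F) := Matrix.mulVecLin (Matrix.of h)
  obtain ⟨v, hv, hcard⟩ := exists_finrank_le_card_support (LinearMap.ker φ)
  have hdim : Fintype.card X ≤ Module.finrank F (LinearMap.ker φ) + Fintype.card K := by
    have h1 := φ.finrank_range_add_finrank_ker
    have h2 := (LinearMap.range φ).finrank_le
    rw [Module.finrank_fintype_fun_eq_card] at h1 h2
    omega
  have hvk : ∀ k, ∑ z, h k z * v z = 0 := fun k => congrFun (LinearMap.mem_ker.mp hv) k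
  let P : Matrix X (I ⊕ J) F :=
    Matrix.of fun x => Sum.elim (fun i => f i x) fun j => ∑ z, g' j x z * v z
  let Q : Matrix (I ⊕ J) X F :=
    Matrix.of (Sum.elim (fun i y => ∑ z, f' i y z * v z) fun j y => g j y)
  have hPQ : Matrix.diagonal v = P * Q := by
    ext x y
    have hsum : ∑ z, (if x = y ∧ x = z then (1 : F) else 0) * v z = Matrix.diagonal v x y := by
      by_cases hxy : x = y <;> simp [hxy]
    have hI : ∑ z, ∑ i, f i x * f' i y z * v z = ∑ i, f i x * ∑ z, f' i y z * v z := by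
      rw [sum_comm]
      simp only [mul_sum, mul_assoc]
    have hJ : ∑ z, ∑ j, g j y * g' j x z * v z = ∑ j, (∑ z, g' j x z * v z) * g j y := by
      rw [sum_comm]
      refine sum_congr rfl fun j _ => ?_
      rw [sum_mul]
      exact sum_congr rfl fun z _ => by ring
    have hK : ∑ z, ∑ k, h k z * h' k x y * v z = 0 := by
      rw [sum_comm]
      refine sum_eq_zero fun k _ => ?_
      rw [← mul_zero (h' k x y), ← hvk k, mul_sum]
      exact sum_congr rfl fun z _ => by ring
    rw [← hsum]
    simp only [hT, add_mul, sum_add_distrib, sum_mul _ _ (v _), hI, hJ, hK, add_zero]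
    simp [Matrix.mul_apply, P, Q]
  have hrank : (Matrix.diagonal v).rank ≤ Fintype.card I + Fintype.card J := by
    rw [hPQ, ← Fintype.card_sum]
    exact (Matrix.rank_mul_le_left P Q).trans (Matrix.rank_le_card_width P)
  rw [Matrix.rank_diagonal, Fintype.card_subtype] at hrank
  omega

open Finset in
/-- If the diagonal tensor is a sum of pure tensors, each with at least one factor in a family
indexed by `E`, then the ambient set has at most `3 * E.card` elements. -/
theorem card_le_three_mul_of_diagonal_eq_sum {F X P Φ : Type*} [Field F] [Fintype X] [Fintype P]
    (m : Φ → X → F) (E : Finset Φ) (c : P → F) (u v w : P → Φ)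
    (hE : ∀ p, c p ≠ 0 → u p ∈ E ∨ v p ∈ E ∨ w p ∈ E)
    (hT : ∀ x y z, (if x = y ∧ x = z then (1 : F) else 0) =
      ∑ p, c p * m (u p) x * m (v p) y * m (w p) z) :
    Fintype.card X ≤ 3 * E.card := by
  have key := card_le_of_diagonal_eq_sum_slices (I := E) (J := E) (K := E)
    (fun e x => m e x)
    (fun e y z => ∑ p, if u p = e then c p * m (v p) y * m (w p) z else 0)
    (fun e y => m e y)
    (fun e x z => ∑ p, if u p ∉ E ∧ v p = e then c p * m (u p) x * m (w p) z else 0)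
    (fun e z => m e z)
    (fun e x y => ∑ p, if u p ∉ E ∧ v p ∉ E ∧ w p = e then c p * m (u p) x * m (v p) y else 0)
    ?_
  · simp only [Fintype.card_coe] at key
    omega
  intro x y z
  rw [hT]
  simp only [mul_sum, mul_ite, mul_zero]
  rw [sum_comm, sum_comm (s := univ (α := E)) (t := univ (α := P)),
    sum_comm (s := univ (α := E)) (t := univ (α := P)), ← sum_add_distrib, ← sum_add_distrib]
  refine sum_congr rfl fun p _ => ?_
  rw [sum_coe_sort E fun e => if u p = e then m e x * (c p * m (v p) y * m (w p) z) else 0,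
    sum_coe_sort E fun e =>
      if u p ∉ E ∧ v p = e then m e y * (c p * m (u p) x * m (w p) z) else 0,
    sum_coe_sort E fun e =>
      if u p ∉ E ∧ v p ∉ E ∧ w p = e then m e z * (c p * m (u p) x * m (v p) y) else 0]
  have := hE p
  by_cases hu : u p ∈ E <;> by_cases hv : v p ∈ E <;> by_cases hw : w p ∈ E <;>
    by_cases hc : c p = 0 <;> simp [hu, hv, hw, hc] at this ⊢ <;> ring

/-- Expansion of `1 - (α x + β y + γ z) ^ m` into monomials of degree at most `m`. -/
theorem exists_one_sub_pow_eq_sum {F : Type*} [Field F] (α β γ : F) (m : ℕ) :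
    ∃ (ι : Type) (_ : Fintype ι) (c : ι → F) (a b d : ι → Fin (m + 1)),
      (∀ i, (a i + b i + d i : ℕ) ≤ m) ∧
      ∀ x y z : F, 1 - (α * x + β * y + γ * z) ^ m =
        ∑ i, c i * x ^ (a i : ℕ) * y ^ (b i : ℕ) * z ^ (d i : ℕ) := by
  refine ⟨Option (Σ k : Fin (m + 1), Fin (k + 1)), inferInstance,
    fun o => o.elim 1 fun s => -(α ^ (s.2 : ℕ) * β ^ (s.1 - s.2 : ℕ) * γ ^ (m - s.1 : ℕ) *
      (Nat.choose s.1 s.2) * (Nat.choose m s.1)),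
    fun o => o.elim 0 fun s => ⟨s.2, by omega⟩,
    fun o => o.elim 0 fun s => ⟨s.1 - s.2, by omega⟩,
    fun o => o.elim 0 fun s => ⟨m - s.1, by omega⟩, ?_, fun x y z => ?_⟩
  · rintro (_ | s)
    · simp
    · simp only [Option.elim]
      omega
  · rw [Fintype.sum_option, Fintype.sum_sigma, add_pow, Finset.sum_range]
    simp only [Option.elim, add_pow, Finset.sum_range, sub_eq_add_neg, ← Finset.sum_neg_distrib,
      Finset.sum_mul]
    congr 1
    · simp
    refine Finset.sum_congr rfl fun k _ => Finset.sum_congr rfl fun j _ => ?_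
    simp only [mul_pow]
    ring

/-- `capm` counts exponent vectors. -/
theorem capm_eq_card_filter (F : Type) [Field F] [Fintype F] (n : ℕ) (d : ℝ) :
    capm F n d = (Finset.univ.filter
      (fun f : Fin n → Fin (Fintype.card F) => ((∑ i, (f i : ℕ) : ℕ) : ℝ) ≤ d)).card := by
  refine Finset.card_image_of_injective _ fun f g hfg => ?_
  have := MvPolynomial.monomial_left_injective (R := F) one_ne_zero hfg
  funext i
  exact Fin.ext (congrFun (Finsupp.equivFunOnFinite.symm.injective this) i)

/-- Over `F_q`, `∏ i, (1 - x i ^ (q - 1))` is the indicator function of the origin. -/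
theorem prod_one_sub_pow_card_sub_one {F : Type*} [Field F] [Fintype F] {n : ℕ} (x : Fin n → F) :
    ∏ i, (1 - x i ^ (Fintype.card F - 1)) = if x = 0 then 1 else 0 := by
  have hq : Fintype.card F - 1 ≠ 0 := (Nat.sub_pos_of_lt Fintype.one_lt_card).ne'
  split_ifs with hx
  · simp [hx, hq]
  · obtain ⟨i, hi⟩ := Function.ne_iff.mp hx
    exact Finset.prod_eq_zero (Finset.mem_univ i)
      (by rw [FiniteField.pow_card_sub_one_eq_one _ hi, sub_self])

/-- Ellenberg–Gijswijt: a "cap set" in `F_q^n` has cardinality at most `3 * m_{(q-1)n/3}`. -/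
theorem ellenberg_gijswijt_bound (F : Type) [Field F] [Fintype F] (n : ℕ) (hn : 0 < n)
    (α β γ : F) (hγ : γ ≠ 0) (habc : α + β + γ = 0)
    (A : Finset (Fin n → F))
    (hA : ∀ a₁ ∈ A, ∀ a₂ ∈ A, ∀ a₃ ∈ A,
      α • a₁ + β • a₂ + γ • a₃ = 0 → a₁ = a₂ ∧ a₁ = a₃) :
    A.card ≤ 3 * capm F n (((Fintype.card F : ℝ) - 1) * n / 3) := by
  obtain ⟨r, hr⟩ : ∃ r, Fintype.card F = r + 1 :=
    ⟨_, (Nat.succ_pred_eq_of_pos Fintype.card_pos).symm⟩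
  rw [capm_eq_card_filter, ← Fintype.card_coe A, hr]
  obtain ⟨ι, _, c, a, b, d, hdeg, hsum⟩ := exists_one_sub_pow_eq_sum α β γ r
  refine card_le_three_mul_of_diagonal_eq_sum (P := Fin n → ι)
    (fun (e : Fin n → Fin (r + 1)) (x : A) => ∏ i, x.1 i ^ (e i : ℕ)) _
    (fun p => ∏ i, c (p i)) (fun p i => a (p i)) (fun p i => b (p i)) (fun p i => d (p i))
    (fun p _ => ?_) fun x y z => ?_
  · simp only [Finset.mem_filter, Finset.mem_univ, true_and]
    by_contra! h
    obtain ⟨h1, h2, h3⟩ := h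
    have hle : ∑ i, (a (p i) + b (p i) + d (p i) : ℕ) ≤ ∑ _i : Fin n, r :=
      Finset.sum_le_sum fun i _ => hdeg (p i)
    simp only [Finset.sum_add_distrib, Finset.sum_const, Finset.card_univ, Fintype.card_fin,
      smul_eq_mul] at hle
    have hle' := (Nat.cast_le (α := ℝ)).mpr hle
    push_cast at h1 h2 h3 hle'
    linarith
  · have hdiag : (x = y ∧ x = z) ↔ α • x.1 + β • y.1 + γ • z.1 = 0 := by
      constructor
      · rintro ⟨rfl, rfl⟩
        rw [← add_smul, ← add_smul, habc, zero_smul]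
      · intro h
        simpa only [Subtype.ext_iff] using hA x x.2 y y.2 z z.2 h
    have hprod := prod_one_sub_pow_card_sub_one (α • x.1 + β • y.1 + γ • z.1)
    simp only [hr, Nat.add_sub_cancel, Pi.add_apply, Pi.smul_apply, smul_eq_mul, hsum,
      Finset.prod_univ_sum, Fintype.piFinset_univ, Finset.prod_mul_distrib] at hprod
    simp only [hdiag, hprod]
end

section
/- Let q be a prime power, F_q a finite field with q elements, n a positive integer, d a real number with d ≥ 0, A ⊆ F_q^n a finite set, and α, β, γ ∈ F_q with α + β + γ = 0. Let P be a polynomial in the F_q-linear span of M_n^d such that P(α·a + β·b) = 0 for all a, b ∈ A with a ≠ b. Then |{a ∈ A : P(−γ·a) ≠ 0}| ≤ 2·m_{d/2}. -/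
attribute [local instance] Classical.propDecidable

/-- The functions of two variables `K` of the form
`K a b = ∑ i, φ i a * G i b + ∑ i, H i a * φ i b`. -/
def sliceSpan {R ι X : Type*} [CommRing R] [Fintype ι] (φ : ι → X → R) :
    Submodule R (X → X → R) where
  carrier := {K | ∃ G H : ι → X → R, ∀ a b, K a b = ∑ i, φ i a * G i b + ∑ i, H i a * φ i b}
  zero_mem' := ⟨0, 0, by simp⟩
  add_mem' := by
    rintro K L ⟨G, H, hK⟩ ⟨G', H', hL⟩
    refine ⟨G + G', H + H', fun a b => ?_⟩
    simp only [Pi.add_apply, hK, hL, mul_add, add_mul, Finset.sum_add_distrib]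
    ring
  smul_mem' := by
    rintro c K ⟨G, H, hK⟩
    refine ⟨c • G, c • H, fun a b => ?_⟩
    simp only [Pi.smul_apply, smul_eq_mul, hK, mul_add, Finset.mul_sum]
    congr 1 <;> exact Finset.sum_congr rfl fun i _ => by ring

theorem mul_left_mem_sliceSpan {R ι X : Type*} [CommRing R] [Fintype ι] (φ : ι → X → R)
    (i : ι) (g : X → R) : (fun a b => φ i a * g b) ∈ sliceSpan φ :=
  ⟨Pi.single i g, 0, fun a b => by
    rw [Finset.sum_eq_single i] <;> simp +contextual⟩

theorem mul_right_mem_sliceSpan {R ι X : Type*} [CommRing R] [Fintype ι] (φ : ι → X → R)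
    (i : ι) (g : X → R) : (fun a b => g a * φ i b) ∈ sliceSpan φ :=
  ⟨0, Pi.single i g, fun a b => by
    rw [add_comm, Finset.sum_eq_single i] <;> simp +contextual⟩

/-- A kernel in `sliceSpan φ` that is diagonal on `A` has at most `2 * card ι` nonzero diagonal
entries. -/
theorem card_filter_diagonal_ne_zero_le {F ι X : Type*} [Field F] [Fintype ι] (φ : ι → X → F)
    {K : X → X → F} (hK : K ∈ sliceSpan φ) (A : Finset X)
    (hA : ∀ a ∈ A, ∀ b ∈ A, a ≠ b → K a b = 0) :
    (A.filter fun a => K a a ≠ 0).card ≤ 2 * Fintype.card ι := by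
  obtain ⟨G, H, hGH⟩ := hK
  let U : Matrix A (ι ⊕ ι) F := Matrix.of fun a => Sum.elim (fun i => φ i a) (fun i => H i a)
  let V : Matrix (ι ⊕ ι) A F := Matrix.of fun j b => Sum.elim (fun i => G i b) (fun i => φ i b) j
  have hUV : Matrix.diagonal (fun a : A => K a a) = U * V := by
    ext a b
    have h : (U * V) a b = K a b := by
      simp [U, V, Matrix.mul_apply, Fintype.sum_sum_type, hGH]
    rw [h, Matrix.diagonal_apply]
    split_ifs with hab
    · rw [hab]
    · exact (hA a a.2 b b.2 fun h => hab (Subtype.ext h)).symm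
  calc (A.filter fun a => K a a ≠ 0).card
      = Fintype.card {a : A // K a a ≠ 0} := by
        rw [Fintype.card_subtype, ← Finset.card_map (Function.Embedding.subtype _)]
        congr 1
        ext a
        simp [and_comm]
    _ = (U * V).rank := by rw [← hUV, Matrix.rank_diagonal]
    _ ≤ U.rank := Matrix.rank_mul_le_left U V
    _ ≤ Fintype.card (ι ⊕ ι) := Matrix.rank_le_card_width U
    _ = 2 * Fintype.card ι := by rw [Fintype.card_sum, two_mul]

/-- The exponent vectors of the monomials in `capM F n d`. -/
noncomputable def capExponents (F : Type) [Fintype F] (n : ℕ) (d : ℝ) :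
    Finset (Fin n → Fin (Fintype.card F)) :=
  Finset.univ.filter fun f => ((∑ i, (f i : ℕ) : ℕ) : ℝ) ≤ d

theorem capm_eq_card_capExponents (F : Type) [Field F] [Fintype F] (n : ℕ) (d : ℝ) :
    capm F n d = (capExponents F n d).card := by
  refine Finset.card_image_of_injective _ fun f g h => ?_
  have h' := MvPolynomial.monomial_left_injective (one_ne_zero : (1 : F) ≠ 0) h
  ext i
  exact congrFun (Finsupp.equivFunOnFinite.symm.injective h') i

/-- The function on `F ^ n` defined by the monomial with exponent vector `e`. -/
def monomialFun {F : Type} [Field F] [Fintype F] {n : ℕ} (e : Fin n → Fin (Fintype.card F))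
    (x : Fin n → F) : F :=
  ∏ i, x i ^ (e i : ℕ)

theorem monomialFun_add_mem_sliceSpan {F : Type} [Field F] [Fintype F] {n : ℕ} {d : ℝ}
    (α β : F) {f : Fin n → Fin (Fintype.card F)} (hf : f ∈ capExponents F n d) :
    (fun a b => monomialFun f (α • a + β • b)) ∈
      sliceSpan fun e : capExponents F n (d / 2) => monomialFun (e : Fin n → _) := by
  have hexp : (fun a b => monomialFun f (α • a + β • b)) =
      ∑ j ∈ Fintype.piFinset fun i => Finset.range ((f i : ℕ) + 1), fun a b : Fin n → F =>
        (∏ i, a i ^ j i) * (∏ i, b i ^ ((f i : ℕ) - j i)) *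
          ∏ i, α ^ j i * β ^ ((f i : ℕ) - j i) * ((f i : ℕ).choose (j i) : F) := by
    ext a b
    simp only [monomialFun, Pi.add_apply, Pi.smul_apply, smul_eq_mul, add_pow,
      Finset.prod_univ_sum, Finset.sum_apply, ← Finset.prod_mul_distrib]
    exact Finset.sum_congr rfl fun j _ => Finset.prod_congr rfl fun i _ => by ring
  rw [hexp]
  refine Submodule.sum_mem _ fun j hj => ?_
  have hle : ∀ i, j i ≤ f i := fun i =>
    Nat.lt_succ_iff.mp (Finset.mem_range.mp (Fintype.mem_piFinset.mp hj i))
  let e : Fin n → Fin (Fintype.card F) := fun i => ⟨j i, (hle i).trans_lt (f i).2⟩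
  let e' : Fin n → Fin (Fintype.card F) := fun i =>
    ⟨f i - j i, (Nat.sub_le _ _).trans_lt (f i).2⟩
  have hsum : ((∑ i, (e i : ℕ) : ℕ) : ℝ) + ((∑ i, (e' i : ℕ) : ℕ) : ℝ) ≤ d := by
    rw [← Nat.cast_add, ← Finset.sum_add_distrib,
      Finset.sum_congr rfl fun i _ => show (e i : ℕ) + e' i = f i from
        Nat.add_sub_of_le (hle i)]
    exact (Finset.mem_filter.mp hf).2
  by_cases he : ((∑ i, (e i : ℕ) : ℕ) : ℝ) ≤ d / 2
  · convert mul_left_mem_sliceSpan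
      (fun e : capExponents F n (d / 2) => monomialFun (e : Fin n → _))
      ⟨e, Finset.mem_filter.mpr ⟨Finset.mem_univ _, he⟩⟩
      (fun b => (∏ i, b i ^ ((f i : ℕ) - j i)) *
        ∏ i, α ^ j i * β ^ ((f i : ℕ) - j i) * ((f i : ℕ).choose (j i) : F)) using 3
    simp [monomialFun, e, mul_assoc]
  · have he' : ((∑ i, (e' i : ℕ) : ℕ) : ℝ) ≤ d / 2 := by linarith
    convert mul_right_mem_sliceSpan
      (fun e : capExponents F n (d / 2) => monomialFun (e : Fin n → _))
      ⟨e', Finset.mem_filter.mpr ⟨Finset.mem_univ _, he'⟩⟩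
      (fun a => (∏ i, a i ^ j i) *
        ∏ i, α ^ j i * β ^ ((f i : ℕ) - j i) * ((f i : ℕ).choose (j i) : F)) using 3
    simp [monomialFun, e', mul_right_comm]

theorem eval_add_mem_sliceSpan {F : Type} [Field F] [Fintype F] {n : ℕ} {d : ℝ} (α β : F)
    {P : MvPolynomial (Fin n) F}
    (hP : P ∈ Submodule.span F (capM F n d : Set (MvPolynomial (Fin n) F))) :
    (fun a b => MvPolynomial.eval (α • a + β • b) P) ∈
      sliceSpan fun e : capExponents F n (d / 2) => monomialFun (e : Fin n → _) := by
  induction hP using Submodule.span_induction with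
  | mem p hp =>
    obtain ⟨f, hf, rfl⟩ := Finset.mem_image.mp (Finset.mem_coe.mp hp)
    convert monomialFun_add_mem_sliceSpan α β hf using 3
    simp [monomialFun, MvPolynomial.eval_monomial, Finsupp.prod_fintype]
  | zero =>
    convert Submodule.zero_mem (sliceSpan _) using 3
    simp
  | add p q _ _ hp hq =>
    convert Submodule.add_mem _ hp hq using 3
    simp
  | smul c p _ hp =>
    convert Submodule.smul_mem _ c hp using 3
    simp [MvPolynomial.smul_eval]

/-- Proposition 2 of Ellenberg–Gijswijt: if `P` lies in the span of `M_n^d` and vanishes at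
`α•a + β•b` for all distinct `a, b ∈ A`, then `P(-γ•a) ≠ 0` for at most `2 * m_{d/2}`
elements `a ∈ A`. -/
theorem proposition_EG (F : Type) [Field F] [Fintype F] (n : ℕ) (hn : 0 < n)
    (d : ℝ) (hd : 0 ≤ d) (α β γ : F) (habc : α + β + γ = 0)
    (A : Finset (Fin n → F)) (P : MvPolynomial (Fin n) F)
    (hP : P ∈ Submodule.span F (capM F n d : Set (MvPolynomial (Fin n) F)))
    (hvanish : ∀ a ∈ A, ∀ b ∈ A, a ≠ b → MvPolynomial.eval (α • a + β • b) P = 0) :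
    (A.filter (fun a => MvPolynomial.eval ((-γ) • a) P ≠ 0)).card ≤ 2 * capm F n (d / 2) := by
  have hγ (a : Fin n → F) : (-γ) • a = α • a + β • a := by
    rw [← add_smul, ← eq_neg_of_add_eq_zero_left habc]
  simp only [hγ]
  rw [capm_eq_card_capExponents, ← Fintype.card_coe (capExponents F n (d / 2))]
  exact card_filter_diagonal_ne_zero_le _ (eval_add_mem_sliceSpan α β hP) A hvanish
end

section
/- Let q be a prime power, F_q a finite field with q elements, n a positive integer, d a real number with 0 ≤ d, γ ∈ F_q with γ ≠ 0, and A ⊆ F_q^n a finite set. Let S_n^d be the F_q-linear span of M_n^d and let V := {p ∈ S_n^d : p(a) = 0 for all a ∈ F_q^n ∖ (−γ·A)}, where −γ·A := {−γ·a : a ∈ A}. Then q^n + dim(V) ≥ m_d + |A|. -/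
attribute [local instance] Classical.propDecidable

theorem finrank_span_capM (F : Type) [Field F] [Fintype F] (n : ℕ) (d : ℝ) :
    Module.finrank F (Submodule.span F (capM F n d : Set (MvPolynomial (Fin n) F))) =
      capm F n d := by
  refine finrank_span_finset_eq_card ?_
  have h := (MvPolynomial.basisMonomials (Fin n) F).linearIndependent.linearIndepOn_id
  rw [MvPolynomial.coe_basisMonomials] at h
  refine h.mono fun p hp => ?_
  obtain ⟨f, -, rfl⟩ := Finset.mem_image.mp (Finset.mem_coe.mp hp)
  exact ⟨_, rfl⟩

/-- Requiring a polynomial from a finite-dimensional space to vanish on a finite set lowers the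
dimension by at most the size of the set. -/
theorem finrank_le_card_add_finrank_vanishing {F σ : Type*} [Field F]
    (S V : Submodule F (MvPolynomial σ F)) [FiniteDimensional F S] (B : Finset (σ → F))
    (hV : ∀ p, p ∈ V ↔ p ∈ S ∧ ∀ a ∈ B, MvPolynomial.eval a p = 0) :
    Module.finrank F S ≤ B.card + Module.finrank F V := by
  let φ : S →ₗ[F] (B → F) :=
    LinearMap.pi (fun a : B => (MvPolynomial.aeval (R := F) (a : σ → F)).toLinearMap) ∘ₗ S.subtype
  have hker : LinearMap.ker φ = V.comap S.subtype := by
    ext p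
    simp [φ, LinearMap.mem_ker, funext_iff, hV]
  have hVS : V ≤ S := fun p hp => ((hV p).mp hp).1
  have hrank := φ.finrank_range_add_finrank_ker
  rw [hker, (Submodule.comapSubtypeEquivOfLe hVS).finrank_eq] at hrank
  have hle := Submodule.finrank_le (LinearMap.range φ)
  rw [Module.finrank_fintype_fun_eq_card, Fintype.card_coe] at hle
  omega

/-- Lower bound on the dimension of the space `V` of polynomials in the span `S_n^d` of
`M_n^d` vanishing on the complement of `-γ • A`: one has `qⁿ + dim V ≥ m_d + |A|`. -/
theorem dim_V_lower_bound (F : Type) [Field F] [Fintype F] (n : ℕ) (hn : 0 < n)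
    (d : ℝ) (hd : 0 ≤ d) (γ : F) (hγ : γ ≠ 0) (A : Finset (Fin n → F))
    (V : Submodule F (MvPolynomial (Fin n) F))
    (hV : ∀ p, p ∈ V ↔
      p ∈ Submodule.span F (capM F n d : Set (MvPolynomial (Fin n) F)) ∧
      ∀ a : Fin n → F, a ∉ A.image (fun x => (-γ) • x) → MvPolynomial.eval a p = 0) :
    capm F n d + A.card ≤ Fintype.card F ^ n + Module.finrank F V := by
  have hinj : Function.Injective fun x : Fin n → F => (-γ) • x :=
    smul_right_injective _ (neg_ne_zero.mpr hγ)
  have hcard := Finset.card_add_card_compl (A.image fun x => (-γ) • x)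
  rw [Finset.card_image_of_injective A hinj, Fintype.card_pi_const] at hcard
  have : FiniteDimensional F
      (Submodule.span F (capM F n d : Set (MvPolynomial (Fin n) F))) :=
    FiniteDimensional.span_finset F _
  have hle := finrank_le_card_add_finrank_vanishing
    (Submodule.span F (capM F n d : Set (MvPolynomial (Fin n) F))) V
    (A.image fun x => (-γ) • x)ᶜ (fun p => by simpa only [Finset.mem_compl] using hV p)
  rw [finrank_span_capM] at hle
  omega
end

section
/- Let q be a prime power, F_q a finite field with q elements, n a positive integer, d a real number with 0 ≤ d, and α, β, γ ∈ F_q with α + β + γ = 0 and γ ≠ 0. Let A ⊆ F_q^n be a finite set such that the only solutions of α·a₁ + β·a₂ + γ·a₃ = 0 with a₁, a₂, a₃ ∈ A are those with a₁ = a₂ = a₃. Let S_n^d be the F_q-linear span of M_n^d, let V := {p ∈ S_n^d : p(a) = 0 for all a ∈ F_q^n ∖ (−γ·A)}, and let P ∈ V have maximal support among elements of V (i.e. for every P' ∈ V, sup(P) ⊆ sup(P') implies sup(P) = sup(P'), where sup(p) := {x ∈ F_q^n : p(x) ≠ 0}). Then |sup(P)| ≤ 2·m_{d/2}. -/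
attribute [local instance] Classical.propDecidable

/-- `sup p`, the set of points of `Fⁿ` at which the polynomial `p` does not vanish. -/
noncomputable def supSet (F : Type) [Field F] [Fintype F] (n : ℕ)
    (p : MvPolynomial (Fin n) F) : Finset (Fin n → F) :=
  Finset.univ.filter (fun x => MvPolynomial.eval x p ≠ 0)

/-- The bivariate functions `E` on `Fⁿ` of the form
`E x y = ∑ m ∈ T, m x * G m y + ∑ m ∈ T, H m x * m y`. -/
def splitSubmodule {F : Type} [Field F] {n : ℕ} (T : Finset (MvPolynomial (Fin n) F)) :
    Submodule F ((Fin n → F) → (Fin n → F) → F) where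
  carrier := {E | ∃ G H : MvPolynomial (Fin n) F → (Fin n → F) → F, ∀ x y,
    E x y = ∑ m ∈ T, MvPolynomial.eval x m * G m y + ∑ m ∈ T, H m x * MvPolynomial.eval y m}
  zero_mem' := ⟨0, 0, by simp⟩
  add_mem' := by
    rintro E E' ⟨G, H, h⟩ ⟨G', H', h'⟩
    refine ⟨G + G', H + H', fun x y => ?_⟩
    simp only [Pi.add_apply, h, h', mul_add, add_mul, Finset.sum_add_distrib]
    ring
  smul_mem' := by
    rintro c E ⟨G, H, h⟩
    refine ⟨c • G, c • H, fun x y => ?_⟩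
    simp only [Pi.smul_apply, smul_eq_mul, h, mul_add, Finset.mul_sum]
    congr 1 <;> exact Finset.sum_congr rfl fun _ _ => by ring

theorem mul_mem_splitSubmodule_left {F : Type} [Field F] {n : ℕ}
    {T : Finset (MvPolynomial (Fin n) F)} {m : MvPolynomial (Fin n) F} (hm : m ∈ T)
    (g : (Fin n → F) → F) :
    (fun x y => MvPolynomial.eval x m * g y) ∈ splitSubmodule T := by
  refine ⟨fun m' y => if m' = m then g y else 0, 0, fun x y => ?_⟩
  simp [hm]

theorem mul_mem_splitSubmodule_right {F : Type} [Field F] {n : ℕ}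
    {T : Finset (MvPolynomial (Fin n) F)} {m : MvPolynomial (Fin n) F} (hm : m ∈ T)
    (h : (Fin n → F) → F) :
    (fun x y => h x * MvPolynomial.eval y m) ∈ splitSubmodule T := by
  refine ⟨0, fun m' x => if m' = m then h x else 0, fun x y => ?_⟩
  simp [hm]

theorem monomial_mem_capM {F : Type} [Field F] [Fintype F] {n : ℕ} {d : ℝ} {k : Fin n → ℕ}
    (hk : ∀ i, k i < Fintype.card F) (hd : ((∑ i, k i : ℕ) : ℝ) ≤ d) :
    MvPolynomial.monomial (Finsupp.equivFunOnFinite.symm k) (1 : F) ∈ capM F n d :=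
  Finset.mem_image.2 ⟨fun i => ⟨k i, hk i⟩, by simpa using hd, rfl⟩

theorem eval_monomial_equivFunOnFinite_symm {F : Type} [Field F] {n : ℕ} (k : Fin n → ℕ)
    (x : Fin n → F) :
    MvPolynomial.eval x (MvPolynomial.monomial (Finsupp.equivFunOnFinite.symm k) (1 : F)) =
      ∏ i, x i ^ k i := by
  simp [MvPolynomial.eval_monomial, Finsupp.prod_fintype]

theorem prod_pow_mul_prod_pow_mem_splitSubmodule {F : Type} [Field F] [Fintype F] {n : ℕ} {d : ℝ}
    {k l : Fin n → ℕ} (hk : ∀ i, k i < Fintype.card F) (hl : ∀ i, l i < Fintype.card F)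
    (hd : ((∑ i, k i : ℕ) : ℝ) + ((∑ i, l i : ℕ) : ℝ) ≤ d) :
    (fun x y : Fin n → F => (∏ i, x i ^ k i) * ∏ i, y i ^ l i) ∈
      splitSubmodule (capM F n (d / 2)) := by
  rcases le_or_gt ((∑ i, k i : ℕ) : ℝ) (d / 2) with h | h
  · simpa only [eval_monomial_equivFunOnFinite_symm] using
      mul_mem_splitSubmodule_left (monomial_mem_capM hk h) fun y : Fin n → F => ∏ i, y i ^ l i
  · have h' : ((∑ i, l i : ℕ) : ℝ) ≤ d / 2 := by linarith
    simpa only [eval_monomial_equivFunOnFinite_symm] using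
      mul_mem_splitSubmodule_right (monomial_mem_capM hl h') fun x : Fin n → F => ∏ i, x i ^ k i

theorem prod_add_pow_eq_sum {F : Type} [Field F] {n : ℕ} (α β : F) (f : Fin n → ℕ)
    (x y : Fin n → F) :
    ∏ i, (α * x i + β * y i) ^ f i =
      ∑ k ∈ Fintype.piFinset fun i => Finset.range (f i + 1),
        (∏ i, α ^ k i * β ^ (f i - k i) * ((f i).choose (k i) : F)) *
          ((∏ i, x i ^ k i) * ∏ i, y i ^ (f i - k i)) := by
  simp only [add_pow, Finset.prod_univ_sum, ← Finset.prod_mul_distrib]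
  refine Finset.sum_congr rfl fun k _ => Finset.prod_congr rfl fun i _ => ?_
  rw [mul_pow, mul_pow]
  ring

/-- For `p` in the span of `M_n^d`, the function `p (α x + β y)` splits along `M_n^{d/2}`. -/
theorem eval_smul_add_smul_mem_splitSubmodule {F : Type} [Field F] [Fintype F] {n : ℕ} {d : ℝ}
    (α β : F) {p : MvPolynomial (Fin n) F}
    (hp : p ∈ Submodule.span F (capM F n d : Set (MvPolynomial (Fin n) F))) :
    (fun x y => MvPolynomial.eval (α • x + β • y) p) ∈ splitSubmodule (capM F n (d / 2)) := by
  induction hp using Submodule.span_induction with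
  | mem p hp =>
    obtain ⟨f, hf, rfl⟩ := Finset.mem_image.1 (Finset.mem_coe.1 hp)
    have hd : ((∑ i, (f i : ℕ) : ℕ) : ℝ) ≤ d := (Finset.mem_filter.1 hf).2
    simp only [eval_monomial_equivFunOnFinite_symm, Pi.add_apply, Pi.smul_apply, smul_eq_mul,
      prod_add_pow_eq_sum]
    have key : ∀ k ∈ Fintype.piFinset fun i => Finset.range ((f i : ℕ) + 1),
        (fun x y : Fin n → F => (∏ i, x i ^ k i) * ∏ i, y i ^ ((f i : ℕ) - k i)) ∈
          splitSubmodule (capM F n (d / 2)) := by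
      intro k hk
      have hkf : ∀ i, k i ≤ f i := fun i =>
        Nat.lt_succ_iff.1 (Finset.mem_range.1 (Fintype.mem_piFinset.1 hk i))
      refine prod_pow_mul_prod_pow_mem_splitSubmodule
        (fun i => (hkf i).trans_lt (f i).2) (fun i => (Nat.sub_le _ _).trans_lt (f i).2) ?_
      rw [← Nat.cast_add, ← Finset.sum_add_distrib]
      simpa only [Nat.add_sub_cancel' (hkf _)] using hd
    convert Submodule.sum_mem _ fun k hk => Submodule.smul_mem _
      (∏ i, α ^ k i * β ^ ((f i : ℕ) - k i) * ((f i : ℕ).choose (k i) : F)) (key k hk) using 1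
    ext x y
    simp [Finset.sum_apply]
  | zero =>
    simp only [map_zero]
    exact Submodule.zero_mem _
  | add p q _ _ hp hq =>
    simp only [map_add]
    exact Submodule.add_mem _ hp hq
  | smul c p _ hp =>
    simp only [MvPolynomial.smul_eval]
    exact Submodule.smul_mem _ c hp

theorem rank_of_mem_splitSubmodule_le {F : Type} [Field F] {n : ℕ}
    {T : Finset (MvPolynomial (Fin n) F)} {E : (Fin n → F) → (Fin n → F) → F}
    (hE : E ∈ splitSubmodule T) {ι : Type} [Fintype ι] (a : ι → Fin n → F) :
    (Matrix.of fun i j => E (a i) (a j)).rank ≤ 2 * T.card := by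
  obtain ⟨G, H, h⟩ := hE
  have key : (Matrix.of fun i j => E (a i) (a j)) =
      Matrix.fromCols (Matrix.of fun (i : ι) (m : T) => MvPolynomial.eval (a i) m.1)
          (Matrix.of fun (i : ι) (m : T) => H m (a i)) *
        Matrix.fromRows (Matrix.of fun (m : T) (j : ι) => G m (a j))
          (Matrix.of fun (m : T) (j : ι) => MvPolynomial.eval (a j) m.1) := by
    rw [Matrix.fromCols_mul_fromRows]
    ext i j
    simp only [Matrix.add_apply, Matrix.mul_apply, Matrix.of_apply, h]
    rw [← Finset.sum_coe_sort T, ← Finset.sum_coe_sort T]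
  rw [key]
  refine ((Matrix.rank_mul_le_left _ _).trans (Matrix.rank_le_card_width _)).trans_eq ?_
  rw [Fintype.card_sum, Fintype.card_coe, two_mul]

/-- Upper bound on the support of an element `P` with maximal support of the space `V` of
polynomials in the span of `M_n^d` vanishing off `-γ • A`: `|sup P| ≤ 2 * m_{d/2}`. -/
theorem max_support_card_le (F : Type) [Field F] [Fintype F] (n : ℕ) (hn : 0 < n)
    (d : ℝ) (hd : 0 ≤ d) (α β γ : F) (habc : α + β + γ = 0) (hγ : γ ≠ 0)
    (A : Finset (Fin n → F))
    (hA : ∀ a₁ ∈ A, ∀ a₂ ∈ A, ∀ a₃ ∈ A,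
      α • a₁ + β • a₂ + γ • a₃ = 0 → a₁ = a₂ ∧ a₁ = a₃)
    (V : Submodule F (MvPolynomial (Fin n) F))
    (hV : ∀ p, p ∈ V ↔
      p ∈ Submodule.span F (capM F n d : Set (MvPolynomial (Fin n) F)) ∧
      ∀ a : Fin n → F, a ∉ A.image (fun x => (-γ) • x) → MvPolynomial.eval a p = 0)
    (P : MvPolynomial (Fin n) F) (hP : P ∈ V)
    (hPmax : ∀ P' ∈ V, supSet F n P ⊆ supSet F n P' → supSet F n P = supSet F n P') :
    (supSet F n P).card ≤ 2 * capm F n (d / 2) := by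
  obtain ⟨hspan, hvan⟩ := (hV P).1 hP
  have hγ' : -γ ≠ 0 := neg_ne_zero.2 hγ
  have hmem : ∀ c : Fin n → F, MvPolynomial.eval c P ≠ 0 → (-γ)⁻¹ • c ∈ A := by
    intro c hc
    by_contra hcA
    refine hc (hvan c fun h => hcA ?_)
    obtain ⟨a, ha, rfl⟩ := Finset.mem_image.1 h
    rwa [inv_smul_smul₀ hγ']
  have hS : ∀ s : supSet F n P, MvPolynomial.eval s.1 P ≠ 0 := fun s =>
    (Finset.mem_filter.1 s.2).2
  have hdiag : (Matrix.of fun s t : supSet F n P =>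
      MvPolynomial.eval (α • ((-γ)⁻¹ • s.1) + β • ((-γ)⁻¹ • t.1)) P) =
      Matrix.diagonal fun s : supSet F n P => MvPolynomial.eval s.1 P := by
    ext s t
    rw [Matrix.of_apply]
    rcases eq_or_ne s t with rfl | hst
    · have hab : α + β = -γ := by linear_combination habc
      rw [Matrix.diagonal_apply_eq, ← add_smul, hab, smul_inv_smul₀ hγ']
    · rw [Matrix.diagonal_apply_ne _ hst]
      by_contra hne
      have h := (hA _ (hmem _ (hS s)) _ (hmem _ (hS t)) _ (hmem _ hne) (by
        rw [smul_smul γ, inv_neg, mul_neg, mul_inv_cancel₀ hγ, neg_one_smul, add_neg_cancel])).1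
      exact hst (Subtype.ext (smul_right_injective _ (inv_ne_zero hγ') h))
  have hrank := rank_of_mem_splitSubmodule_le (eval_smul_add_smul_mem_splitSubmodule α β hspan)
    fun s : supSet F n P => (-γ)⁻¹ • s.1
  rw [hdiag, Matrix.rank_diagonal] at hrank
  simpa [hS, capm] using hrank
end

section
/- Let q be a prime power, F_q a finite field with q elements, n a positive integer, d a real number with 0 ≤ d ≤ (q−1)n, and α, β, γ ∈ F_q with α + β + γ = 0 and γ ≠ 0. Let A ⊆ F_q^n be a finite set such that the only solutions of α·a₁ + β·a₂ + γ·a₃ = 0 with a₁, a₂, a₃ ∈ A are those with a₁ = a₂ = a₃. Then |A| ≤ 2·m_{d/2} + m_{(q−1)n−d}. -/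
attribute [local instance] Classical.propDecidable

open Finset in
/-- An injective linear map into functions on a finite set `X` takes a value supported in `B` whose
support has at least `dim V - |X \ B|` elements. -/
theorem exists_support_card_ge {K V X : Type*} [Field K] [AddCommGroup V] [Module K V]
    [FiniteDimensional K V] [Fintype X] (φ : V →ₗ[K] X → K) (hφ : Function.Injective φ)
    (B : Finset X) :
    ∃ v, (∀ x ∉ B, φ v x = 0) ∧
      Module.finrank K V + #B ≤ #{x | φ v x ≠ 0} + Fintype.card X := by
  obtain ⟨S, hS, hmax⟩ := exists_max_image
    ({S | ∃ v, (∀ x ∉ B, φ v x = 0) ∧ S = ({x | φ v x ≠ 0} : Finset X)} : Finset (Finset X)) card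
    ⟨∅, by simpa using ⟨0, by simp, by simp⟩⟩
  obtain ⟨v, hv, rfl⟩ := (mem_filter.1 hS).2
  refine ⟨v, hv, ?_⟩
  by_contra! hlt
  set S : Finset X := {x | φ v x ≠ 0}
  let T : V →ₗ[K] {x // x ∈ S ∪ Bᶜ} → K := (LinearMap.funLeft K K Subtype.val).comp φ
  have hT : LinearMap.ker T ≠ ⊥ := by
    apply LinearMap.ker_ne_bot_of_finrank_lt
    rw [Module.finrank_fintype_fun_eq_card, Fintype.card_coe]
    have h₁ := card_union_le S Bᶜ
    have h₂ := card_add_card_compl B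
    omega
  obtain ⟨w, hw, hw0⟩ := (Submodule.ne_bot_iff _).1 hT
  have hwz : ∀ x, (x ∈ S ∨ x ∉ B) → φ w x = 0 := fun x hx =>
    congr_fun (LinearMap.mem_ker.1 hw) ⟨x, by simpa using hx⟩
  obtain ⟨x, hx⟩ : ∃ x, φ w x ≠ 0 := by
    by_contra! h
    exact hw0 (hφ (by rw [map_zero]; exact funext h))
  have hxS : x ∉ S := fun h => hx (hwz x (.inl h))
  have hle := hmax {x | φ (v + w) x ≠ 0} (mem_filter.2 ⟨mem_univ _, v + w, fun y hy => by
    simp [hv y hy, hwz y (.inr hy)], rfl⟩)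
  refine (card_lt_card (s := S) ?_).not_ge hle
  rw [ssubset_iff]
  refine ⟨x, hxS, insert_subset ?_ fun y hy => ?_⟩
  · have : φ v x = 0 := by simpa [S] using hxS
    simpa [this] using hx
  · have := hwz y (.inl hy)
    simpa [this] using (mem_filter.1 hy).2

/-- Exponent vectors with entries below `q` and total degree at most `d`. -/
noncomputable def expVec (q n : ℕ) (d : ℝ) : Finset (Fin n → Fin q) :=
  {f | ((∑ i, (f i : ℕ) : ℕ) : ℝ) ≤ d}

theorem mem_expVec {q n : ℕ} {d : ℝ} {f : Fin n → Fin q} :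
    f ∈ expVec q n d ↔ ((∑ i, (f i : ℕ) : ℕ) : ℝ) ≤ d := by
  simp [expVec]

theorem capm_eq_card_expVec (F : Type) [Field F] [Fintype F] (n : ℕ) (d : ℝ) :
    capm F n d = (expVec (Fintype.card F) n d).card := by
  refine Finset.card_image_of_injective _ fun f g h => ?_
  have h' := Finsupp.equivFunOnFinite.symm.injective
    (MvPolynomial.monomial_left_injective one_ne_zero h)
  exact funext fun i => Fin.ext (congr_fun h' i)

open Finset in
/-- Reversing exponents sends the vectors of degree greater than `d` to vectors of degree at most
`(q - 1) n - d`. -/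
theorem pow_le_card_expVec_add (q n : ℕ) (d : ℝ) :
    q ^ n ≤ #(expVec q n d) + #(expVec q n (((q : ℝ) - 1) * n - d)) := by
  have hcard : #(expVec q n d)ᶜ ≤ #(expVec q n (((q : ℝ) - 1) * n - d)) := by
    refine card_le_card_of_injOn (fun f i => (f i).rev) (fun f hf => ?_)
      (fun f _ g _ h => funext fun i => Fin.rev_injective (congr_fun h i))
    simp only [coe_compl, Set.mem_compl_iff, mem_coe, mem_expVec, not_le] at hf ⊢
    have h : ∀ i, (((f i).rev : ℕ) : ℝ) = (q : ℝ) - 1 - (f i : ℕ) := fun i => by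
      rw [Fin.val_rev, Nat.cast_sub (f i).isLt]
      push_cast
      ring
    push_cast at hf ⊢
    simp only [h, sum_sub_distrib, sum_const, card_univ, Fintype.card_fin, nsmul_eq_mul]
    linarith
  have := card_add_card_compl (expVec q n d)
  simp only [Fintype.card_fun, Fintype.card_fin] at this
  omega

open Finset in
/-- The polynomial function with the given coefficients on the reduced monomials. -/
noncomputable def evalCoeff {F : Type*} [Field F] {q n : ℕ} (S : Finset (Fin n → Fin q)) :
    (S → F) →ₗ[F] (Fin n → F) → F where
  toFun c x := ∑ f : S, c f * ∏ i, x i ^ (f.1 i : ℕ)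
  map_add' c c' := by ext x; simp [add_mul, sum_add_distrib]
  map_smul' a c := by ext x; simp [mul_sum, mul_assoc]

open Finset in
theorem evalCoeff_injective {F : Type} [Field F] [Fintype F] {n : ℕ}
    (S : Finset (Fin n → Fin (Fintype.card F))) :
    Function.Injective (evalCoeff (F := F) S) := by
  rw [injective_iff_map_eq_zero]
  intro c hc
  let e : S → (Fin n →₀ ℕ) := fun f => Finsupp.equivFunOnFinite.symm fun i => (f.1 i : ℕ)
  have he : Function.Injective e := fun f g h => Subtype.ext <| funext fun i =>
    Fin.ext (congr_fun (Finsupp.equivFunOnFinite.symm.injective h) i)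
  let p : MvPolynomial (Fin n) F := ∑ f : S, MvPolynomial.monomial (e f) (c f)
  have hp : p = 0 := by
    refine MvPolynomial.eq_zero_of_eval_eq_zero _ _ p (fun x => ?_) ?_
    · refine Eq.trans ?_ (congr_fun hc x)
      simp [p, e, evalCoeff, MvPolynomial.eval_monomial, Finsupp.prod_fintype]
    · refine Submodule.sum_mem _ fun f _ => ?_
      rw [MvPolynomial.mem_restrictDegree]
      intro s hs i
      rw [mem_singleton.1 (MvPolynomial.support_monomial_subset hs)]
      exact Nat.le_sub_one_of_lt (f.1 i).isLt
  ext f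
  have h := congr_arg (MvPolynomial.coeff (e f)) hp
  simpa [p, MvPolynomial.coeff_sum, MvPolynomial.coeff_monomial, he.eq_iff] using h

open Finset in
/-- If `P` has degree at most `d`, the matrix `P (α a + β b)` has rank at most `2 m_{d/2}`. -/
theorem rank_evalCoeff_le {F A : Type*} [Field F] [Fintype A] {q n : ℕ} {d : ℝ}
    (α β : F) (a : A → Fin n → F) (c : expVec q n d → F) :
    (Matrix.of fun x y => evalCoeff _ c (α • a x + β • a y)).rank ≤ 2 * #(expVec q n (d / 2)) := by
  let X : Matrix A (expVec q n (d / 2)) F := .of fun x g => ∏ i, a x i ^ (g.1 i : ℕ)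
  let L : Matrix (expVec q n (d / 2)) A F × Matrix A (expVec q n (d / 2)) F →ₗ[F] Matrix A A F :=
    { toFun := fun U => X * U.1 + U.2 * X.transpose
      map_add' := fun U U' => by simp only [Prod.fst_add, Prod.snd_add, Matrix.mul_add, Matrix.add_mul]; abel
      map_smul' := fun r U => by simp }
  have hL : (Matrix.of fun x y => evalCoeff _ c (α • a x + β • a y)) ∈ LinearMap.range L := by
    have hexp : (Matrix.of fun x y => evalCoeff _ c (α • a x + β • a y)) =
        ∑ f : expVec q n d, ∑ g ∈ Fintype.piFinset fun i => range ((f.1 i : ℕ) + 1),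
          (c f * ∏ i, (α ^ g i * β ^ ((f.1 i : ℕ) - g i) * ((f.1 i : ℕ).choose (g i) : F))) •
          Matrix.vecMulVec (fun x => ∏ i, a x i ^ g i)
            (fun y => ∏ i, a y i ^ ((f.1 i : ℕ) - g i)) := by
      ext x y
      simp only [evalCoeff, LinearMap.coe_mk, AddHom.coe_mk, Matrix.of_apply, Matrix.sum_apply,
        Matrix.smul_apply, Matrix.vecMulVec_apply, Pi.add_apply, Pi.smul_apply, smul_eq_mul,
        add_pow, prod_univ_sum, mul_sum]
      refine sum_congr rfl fun f _ => sum_congr rfl fun g _ => ?_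
      rw [mul_assoc, ← prod_mul_distrib, ← prod_mul_distrib]
      congr 1
      refine prod_congr rfl fun i _ => ?_
      rw [mul_pow, mul_pow]
      ring
    rw [hexp]
    refine Submodule.sum_mem _ fun f _ => Submodule.sum_mem _ fun g hg =>
      Submodule.smul_mem _ _ ?_
    have hle : ∀ i, g i ≤ f.1 i := fun i =>
      Nat.lt_succ_iff.1 (mem_range.1 (Fintype.mem_piFinset.1 hg i))
    have hdeg := mem_expVec.1 f.2
    have hsum : ∑ i, g i + ∑ i, ((f.1 i : ℕ) - g i) = ∑ i, (f.1 i : ℕ) := by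
      rw [← sum_add_distrib]
      exact sum_congr rfl fun i _ => Nat.add_sub_cancel' (hle i)
    rw [← hsum, Nat.cast_add] at hdeg
    obtain h | h : ((∑ i, g i : ℕ) : ℝ) ≤ d / 2 ∨ ((∑ i, ((f.1 i : ℕ) - g i) : ℕ) : ℝ) ≤ d / 2 := by
      by_contra! h
      linarith [h.1, h.2]
    · let s : expVec q n (d / 2) :=
        ⟨fun i => ⟨g i, (hle i).trans_lt (f.1 i).isLt⟩, mem_expVec.2 h⟩
      refine ⟨(Matrix.vecMulVec (Pi.single s 1) fun y => ∏ i, a y i ^ ((f.1 i : ℕ) - g i), 0), ?_⟩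
      ext x y
      simp [L, X, s, Matrix.mul_apply, Matrix.vecMulVec_apply, Pi.single_apply]
    · let s : expVec q n (d / 2) :=
        ⟨fun i => ⟨(f.1 i : ℕ) - g i, (Nat.sub_le _ _).trans_lt (f.1 i).isLt⟩, mem_expVec.2 h⟩
      refine ⟨(0, Matrix.vecMulVec (fun x => ∏ i, a x i ^ g i) (Pi.single s 1)), ?_⟩
      ext x y
      simp [L, X, s, Matrix.mul_apply, Matrix.vecMulVec_apply, Pi.single_apply]
  obtain ⟨U, hU⟩ := hL
  have hblock : L U = Matrix.fromCols X U.2 * Matrix.fromRows U.1 X.transpose :=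
    (Matrix.fromCols_mul_fromRows ..).symm
  rw [← hU, hblock]
  refine (Matrix.rank_mul_le_left _ _).trans ((Matrix.rank_le_card_width _).trans_eq ?_)
  rw [Fintype.card_sum, Fintype.card_coe, two_mul]

/-- A generalized cap set `A ⊆ F_qⁿ` satisfies `|A| ≤ 2 * m_{d/2} + m_{(q-1)n-d}`. -/
theorem card_le_two_capm_add (F : Type) [Field F] [Fintype F] (n : ℕ) (hn : 0 < n)
    (d : ℝ) (hd : 0 ≤ d) (hd2 : d ≤ ((Fintype.card F : ℝ) - 1) * n)
    (α β γ : F) (habc : α + β + γ = 0) (hγ : γ ≠ 0)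
    (A : Finset (Fin n → F))
    (hA : ∀ a₁ ∈ A, ∀ a₂ ∈ A, ∀ a₃ ∈ A,
      α • a₁ + β • a₂ + γ • a₃ = 0 → a₁ = a₂ ∧ a₁ = a₃) :
    A.card ≤ 2 * capm F n (d / 2) + capm F n (((Fintype.card F : ℝ) - 1) * n - d) := by
  simp only [capm_eq_card_expVec]
  let neg : (Fin n → F) → Fin n → F := fun x => -(γ • x)
  have hneg : Function.Injective neg := fun x y h => smul_right_injective _ hγ (neg_injective h)
  obtain ⟨c, hc, hcard⟩ := exists_support_card_ge (evalCoeff (F := F) (expVec (Fintype.card F) n d))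
    (evalCoeff_injective _) (A.image neg)
  set P := evalCoeff (expVec (Fintype.card F) n d) c
  have hdiag : (Matrix.of fun x y : A => P (α • x.1 + β • y.1)) =
      Matrix.diagonal fun x : A => P (neg x) := by
    ext x y
    rw [Matrix.of_apply, Matrix.diagonal_apply]
    split_ifs with hxy
    · subst hxy
      congr 1
      rw [← add_smul, eq_neg_of_add_eq_zero_left habc, neg_smul]
    · refine hc _ fun hmem => hxy ?_
      obtain ⟨z, hz, h⟩ := Finset.mem_image.1 hmem
      refine Subtype.ext (hA _ x.2 _ y.2 z hz ?_).1
      rw [← h]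
      exact neg_add_cancel _
  have hrank := rank_evalCoeff_le α β (fun x : A => x.1) c
  rw [hdiag, Matrix.rank_diagonal, Fintype.card_subtype] at hrank
  have hsupp : (Finset.univ.filter fun x => P x ≠ 0).card ≤
      (Finset.univ.filter fun x : A => P (neg x) ≠ 0).card := by
    refine Finset.card_le_card_of_surjOn (fun x : A => neg x) fun y hy => ?_
    have hy' : P y ≠ 0 := by simpa using hy
    obtain ⟨z, hz, rfl⟩ := Finset.mem_image.1 (not_imp_comm.1 (hc y) hy')
    exact ⟨⟨z, hz⟩, by simpa using hy', rfl⟩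
  rw [Finset.card_image_of_injective _ hneg, Module.finrank_fintype_fun_eq_card, Fintype.card_coe,
    Fintype.card_fun, Fintype.card_fin] at hcard
  have hpow := pow_le_card_expVec_add (Fintype.card F) n d
  omega
end

section
/- Let q be a prime power, F_q a finite field with q elements, n a positive integer, and r a real number with 0 < r < 1. Then m_{(q−1)n/3} ≤ C_{r,q}^n, where C_{r,q} := (1 + r + r² + ⋯ + r^{q−1}) / r^{(q−1)/3}. -/
attribute [local instance] Classical.propDecidable

/-- The constant `C_{r,q} = (1 + r + ⋯ + r^{q-1}) / r^((q-1)/3)`. -/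
noncomputable def Crq (r : ℝ) (q : ℕ) : ℝ :=
  (∑ k ∈ Finset.range q, r ^ k) / r ^ (((q : ℝ) - 1) / 3)

/-- Chernoff-type bound: the tuples in `{0, …, q-1}ⁿ` of sum at most `d`, counted with the weight
`r ^ d` for `0 < r ≤ 1`, are dominated by the `n`-th power of the generating function. -/
theorem card_filter_sum_le_mul_rpow_le (q n : ℕ) (d r : ℝ) (hr : 0 < r) (hr1 : r ≤ 1) :
    ((Finset.univ.filter
      (fun f : Fin n → Fin q => ((∑ i, (f i : ℕ) : ℕ) : ℝ) ≤ d)).card : ℝ) * r ^ d ≤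
      (∑ k ∈ Finset.range q, r ^ k) ^ n := by
  calc
    _ = ∑ _f ∈ Finset.univ.filter
          (fun f : Fin n → Fin q => ((∑ i, (f i : ℕ) : ℕ) : ℝ) ≤ d), r ^ d := by
      rw [Finset.sum_const, nsmul_eq_mul]
    _ ≤ ∑ f ∈ Finset.univ.filter
          (fun f : Fin n → Fin q => ((∑ i, (f i : ℕ) : ℕ) : ℝ) ≤ d), ∏ i, r ^ (f i : ℕ) := by
      refine Finset.sum_le_sum fun f hf => ?_
      rw [Finset.prod_pow_eq_pow_sum, ← Real.rpow_natCast]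
      exact Real.rpow_le_rpow_of_exponent_ge hr hr1 (Finset.mem_filter.mp hf).2
    _ ≤ ∑ f : Fin n → Fin q, ∏ i, r ^ (f i : ℕ) :=
      Finset.sum_le_sum_of_subset_of_nonneg (Finset.filter_subset _ _) fun f _ _ => by positivity
    _ = (∑ k ∈ Finset.range q, r ^ k) ^ n := by
      rw [Finset.sum_range, Fintype.sum_pow]

/-- The main asymptotic estimate: `m_{(q-1)n/3} ≤ C_{r,q}ⁿ` for any `0 < r < 1`. -/
theorem capm_le_Crq_pow (F : Type) [Field F] [Fintype F] (n : ℕ) (hn : 0 < n)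
    (r : ℝ) (hr : 0 < r) (hr1 : r < 1) :
    (capm F n (((Fintype.card F : ℝ) - 1) * n / 3) : ℝ) ≤ Crq r (Fintype.card F) ^ n := by
  have hd : r ^ (((Fintype.card F : ℝ) - 1) * n / 3) =
      (r ^ (((Fintype.card F : ℝ) - 1) / 3)) ^ n := by
    rw [← Real.rpow_mul_natCast hr.le]
    ring_nf
  rw [Crq, div_pow, ← hd, le_div_iff₀ (Real.rpow_pos_of_pos hr _)]
  refine le_trans ?_ (card_filter_sum_le_mul_rpow_le (Fintype.card F) n
    (((Fintype.card F : ℝ) - 1) * n / 3) r hr hr1.le)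
  refine mul_le_mul_of_nonneg_right ?_ (Real.rpow_nonneg hr.le _)
  exact Nat.cast_le.mpr Finset.card_image_le
end

section
/- For every natural number q with q > 1, there exists a real number r with 0 < r < 1 such that C_{r,q} < q. -/
theorem sum_range_cast_real (q : ℕ) :
    ∑ k ∈ Finset.range q, (k : ℝ) = (q : ℝ) * ((q : ℝ) - 1) / 2 := by
  induction q with
  | zero => simp
  | succ n ih =>
    rw [Finset.sum_range_succ, ih]
    push_cast
    ring

theorem hasDerivAt_sum_pow_sub_mul_rpow_one (q : ℕ) :
    HasDerivAt (fun r : ℝ => ∑ k ∈ Finset.range q, r ^ k - q * r ^ (((q : ℝ) - 1) / 3))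
      ((q : ℝ) * ((q : ℝ) - 1) / 6) 1 := by
  have hsum : HasDerivAt (fun r : ℝ => ∑ k ∈ Finset.range q, r ^ k)
      (∑ k ∈ Finset.range q, (k : ℝ) * 1 ^ (k - 1)) 1 :=
    HasDerivAt.fun_sum fun k _ => hasDerivAt_pow k 1
  have hrpow := (Real.hasDerivAt_rpow_const (x := 1) (p := ((q : ℝ) - 1) / 3)
    (Or.inl one_ne_zero)).const_mul (q : ℝ)
  refine (hsum.fun_sub hrpow).congr_deriv ?_
  simp only [one_pow, mul_one, Real.one_rpow, sum_range_cast_real]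
  ring

/-- For every `q > 1` there is some `0 < r < 1` with `C_{r,q} < q`. -/
theorem exists_Crq_lt (q : ℕ) (hq : 1 < q) :
    ∃ r : ℝ, 0 < r ∧ r < 1 ∧ Crq r q < q := by
  have hq' : (1 : ℝ) < q := by exact_mod_cast hq
  have hderiv := hasDerivAt_sum_pow_sub_mul_rpow_one q
  have hpos : 0 < (q : ℝ) * ((q : ℝ) - 1) / 6 := by
    have := sub_pos.2 hq'
    positivity
  have hsign := eventually_nhdsWithin_sign_eq_of_deriv_pos (hderiv.deriv ▸ hpos) (by simp)
  obtain ⟨r, hr, hr0, hr1⟩ := ((hsign.filter_mono nhdsWithin_le_nhds).and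
    (Ioo_mem_nhdsLT (zero_lt_one' ℝ))).exists
  refine ⟨r, hr0, hr1, ?_⟩
  rw [sign_neg (sub_neg.2 hr1), sign_eq_neg_one_iff] at hr
  rw [Crq, div_lt_iff₀ (Real.rpow_pos_of_pos hr0 _)]
  exact sub_neg.1 hr
end

section
/- Let r := (√33 − 1)/8. Then 0 < r < 1 and C_{r,3} = ((3/8)^3 · (207 + 33·√33))^(1/3); moreover this value is strictly less than 3 (indeed less than 2.755105). -/
theorem Crq_three_nonneg {r : ℝ} (hr : 0 < r) : 0 ≤ Crq r 3 := by
  unfold Crq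
  positivity

theorem Crq_three_pow_three {r : ℝ} (hr : 0 < r) :
    Crq r 3 ^ 3 = (1 + r + r ^ 2) ^ 3 / r ^ 2 := by
  have hpow : (r ^ ((((3 : ℕ) : ℝ) - 1) / 3)) ^ 3 = r ^ 2 := by
    rw [← Real.rpow_natCast, ← Real.rpow_mul hr.le, ← Real.rpow_natCast]
    norm_num
  simp only [Crq, div_pow, hpow, Finset.sum_range_succ, Finset.sum_range_zero]
  ring

/-- For `r = (√33 - 1)/8` one has `0 < r < 1` and
`C_{r,3} = ((3/8)³ (207 + 33√33))^(1/3)`, a value less than `3` (indeed less than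
`2.755105`). -/
theorem Crq_three_value :
    0 < (Real.sqrt 33 - 1) / 8 ∧ (Real.sqrt 33 - 1) / 8 < 1 ∧
    Crq ((Real.sqrt 33 - 1) / 8) 3 =
      ((3 / 8 : ℝ) ^ 3 * (207 + 33 * Real.sqrt 33)) ^ ((1 : ℝ) / 3) ∧
    Crq ((Real.sqrt 33 - 1) / 8) 3 < 3 ∧
    Crq ((Real.sqrt 33 - 1) / 8) 3 < 2.755105 := by
  have hsq : √(33 : ℝ) ^ 2 = 33 := Real.sq_sqrt (by norm_num)
  have hlow : 1 < √(33 : ℝ) := Real.lt_sqrt_of_sq_lt (by norm_num)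
  have hupp : √(33 : ℝ) < 5.744563 := (Real.sqrt_lt' (by norm_num)).2 (by norm_num)
  have hr : 0 < (√(33 : ℝ) - 1) / 8 := by linarith
  have hC := Crq_three_nonneg hr
  have hcube : Crq ((√33 - 1) / 8) 3 ^ 3 = (3 / 8 : ℝ) ^ 3 * (207 + 33 * √33) := by
    rw [Crq_three_pow_three hr, div_eq_iff (by positivity)]
    generalize √(33 : ℝ) = s at hsq
    grind
  have hlt : Crq ((√33 - 1) / 8) 3 < 2.755105 := by
    refine lt_of_pow_lt_pow_left₀ 3 (by norm_num) ?_
    rw [hcube]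
    norm_num at hupp ⊢
    linarith
  refine ⟨hr, by linarith, ?_, hlt.trans (by norm_num), hlt⟩
  rw [← hcube, ← Real.rpow_natCast, ← Real.rpow_mul hC]
  norm_num
end
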